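/- arXiv:1509.06271 — 10 statements merged into one kernel-verified Lean document; each statement's English description precedes it below -/
import Mathlib

section
/- Let A be a unital C*-algebra over ℂ and let ξ : A → A be a *-ring automorphism, i.e. a bijective additive and multiplicative map with ξ(a*) = ξ(a)* for all a (ξ may be ℂ-linear or conjugate-linear). Then the following are equivalent: (i) for every unitary u ∈ A and every unitary λ in the center Z(A) one has (λu)·ξ(λu) = u·ξ(u); (ii) for every unitary λ ∈ Z(A) one has ξ(λ*) = λ. -/
/-- For a *-ring automorphism `ξ` of a unital C*-algebra, the map `φ_ξ(u) = u·ξ(u)` is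
invariant under left multiplication of `u` by central unitaries if and only if
`ξ(λ*) = λ` for every central unitary `λ`. -/
theorem phi_invariant_iff_fixes_center {A : Type*} [CStarAlgebra A] (ξ : A → A)
    (hbij : Function.Bijective ξ)
    (hadd : ∀ a b : A, ξ (a + b) = ξ a + ξ b)
    (hmul : ∀ a b : A, ξ (a * b) = ξ a * ξ b)
    (hstar : ∀ a : A, ξ (star a) = star (ξ a)) :
    (∀ u : A, star u * u = 1 → u * star u = 1 →
      ∀ lam : A, lam ∈ Set.center A → star lam * lam = 1 → lam * star lam = 1 →
        (lam * u) * ξ (lam * u) = u * ξ u) ↔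
    (∀ lam : A, lam ∈ Set.center A → star lam * lam = 1 → lam * star lam = 1 →
      ξ (star lam) = lam) := by
  have star_map_eq (lam : A) : ξ (star lam) = lam ↔ ξ lam = star lam := by
    rw [hstar, star_eq_iff_star_eq, eq_comm]
  constructor
  · intro h lam hlam hleft hright
    obtain ⟨e, he⟩ := hbij.surjective 1
    have map_one : ξ 1 = 1 := by
      simpa [he] using (hmul 1 e).symm
    have hprod : lam * ξ lam = 1 := by
      simpa [map_one] using h 1 (by simp) (by simp) lam hlam hleft hright
    exact (star_map_eq lam).2 (left_inv_eq_right_inv hleft hprod).symm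
  · intro h u _ _ lam hlam hleft hright
    have hcomm : lam * u = u * lam := Semigroup.mem_center_iff.1 hlam u |>.symm
    rw [hmul, (star_map_eq lam).1 (h lam hlam hleft hright), hcomm, mul_assoc,
      ← mul_assoc lam, hright, one_mul]
end

section
/- Let A be a unital C*-algebra over ℂ, let ξ : A → A be a *-ring automorphism of order two (ξ∘ξ = id), let u ∈ A be a unitary, and set ξ'(a) = u·ξ(a)·u* for all a ∈ A. Then: (1) ξ' and ξ commute (ξ'∘ξ = ξ∘ξ') if and only if u·ξ(u*) lies in the center Z(A); (2) if u·ξ(u*) ∈ Z(A) and ξ fixes Z(A) pointwise (ξ(z) = z for all z ∈ Z(A)), then (u·ξ(u*))² = 1. -/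
/-- Conjugations by two unitaries `u` and `v` agree iff `u * star v` is central. -/
theorem forall_conj_eq_conj_iff_mul_star_mem_center {R : Type*} [Ring R] [StarRing R]
    {u v : R} (hu : u ∈ unitary R) (hv : v ∈ unitary R) :
    (∀ a : R, u * a * star u = v * a * star v) ↔ u * star v ∈ Set.center R := by
  obtain ⟨hu, -⟩ := Unitary.mem_iff.mp hu
  obtain ⟨hv, hv'⟩ := Unitary.mem_iff.mp hv
  rw [Semigroup.mem_center_iff]
  constructor
  · intro h b
    calc b * (u * star v)
        = (v * star v) * b * (v * star v) * (u * star v) := by rw [hv', one_mul, mul_one]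
      _ = v * (star v * b * v) * star v * (u * star v) := by simp only [mul_assoc]
      _ = u * (star v * b * v) * star u * (u * star v) := by rw [h]
      _ = u * star v * b * v * (star u * u) * star v := by simp only [mul_assoc]
      _ = u * star v * b * (v * star v) := by rw [hu, mul_one, mul_assoc _ v]
      _ = u * star v * b := by rw [hv', mul_one]
  · intro h a
    calc u * a * star u
        = u * (star v * v) * a * star u := by rw [hv, mul_one]
      _ = (u * star v) * (v * a * star u) := by simp only [mul_assoc]
      _ = (v * a * star u) * (u * star v) := (h _).symm
      _ = v * a * (star u * u) * star v := by simp only [mul_assoc]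
      _ = v * a * star v := by rw [hu, mul_one]

/-- Let `ξ` be a *-ring automorphism of order two of a unital C*-algebra and `u` a unitary;
set `ξ' = Ad_u ∘ ξ`.  Then (1) `ξ'` and `ξ` commute iff `u·ξ(u*)` is central, and
(2) if `u·ξ(u*)` is central and `ξ` fixes the center pointwise, then `(u·ξ(u*))² = 1`. -/
theorem ad_comp_commutes_iff_and_sq_one {A : Type*} [CStarAlgebra A] (ξ : A → A)
    (hbij : Function.Bijective ξ)
    (hadd : ∀ a b : A, ξ (a + b) = ξ a + ξ b)
    (hmul : ∀ a b : A, ξ (a * b) = ξ a * ξ b)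
    (hstar : ∀ a : A, ξ (star a) = star (ξ a))
    (hinvol : ∀ a : A, ξ (ξ a) = a)
    (u : A) (hu : star u * u = 1) (hu' : u * star u = 1) :
    ((∀ a : A, u * ξ (ξ a) * star u = ξ (u * ξ a * star u)) ↔
      u * ξ (star u) ∈ Set.center A) ∧
    (u * ξ (star u) ∈ Set.center A → (∀ z ∈ Set.center A, ξ z = z) →
      (u * ξ (star u)) ^ 2 = 1) := by
  have hone : ξ 1 = 1 := by
    calc ξ 1 = ξ 1 * ξ (ξ 1) := by rw [hinvol, mul_one]
      _ = 1 := by rw [← hmul, one_mul, hinvol]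
  have huu : u ∈ unitary A := Unitary.mem_iff.mpr ⟨hu, hu'⟩
  have hξu : ξ u ∈ unitary A :=
    Unitary.mem_iff.mpr ⟨by rw [← hstar, ← hmul, hu, hone], by rw [← hstar, ← hmul, hu', hone]⟩
  constructor
  · simp only [hmul, hinvol, hstar]
    exact forall_conj_eq_conj_iff_mul_star_mem_center huu hξu
  · intro hc hfix
    have hsa : star (u * ξ (star u)) = u * ξ (star u) := by
      simpa only [hmul, hinvol, hstar, star_mul, star_star] using hfix _ hc
    have hunit : u * ξ (star u) ∈ unitary A := by
      rw [hstar]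
      exact mul_mem huu (Unitary.star_mem hξu)
    rw [sq]
    nth_rewrite 1 [← hsa]
    exact (Unitary.mem_iff.mp hunit).1
end

section
/- Let A be a unital C*-algebra over ℂ, let ξ : A → A be a *-ring automorphism of order two (ξ∘ξ = id), let u ∈ A be a unitary, and set ξ'(a) = u·ξ(a)·u*. Then ξ' has order two (ξ'∘ξ' = id) if and only if u·ξ(u) lies in the center Z(A). Moreover, if u·ξ(u) ∈ Z(A), then: (a) ξ(u)·u = u·ξ(u) and ξ(u·ξ(u)) = u·ξ(u); (b) u·ξ'(u) = u·ξ(u). -/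
/-- Let `ξ` be a *-ring automorphism of order two of a unital C*-algebra and `u` a unitary;
set `ξ'(a) = u·ξ(a)·u*`.  Then `ξ'` has order two iff `u·ξ(u)` is central; moreover if
`u·ξ(u)` is central then (a) `ξ(u)·u = u·ξ(u)` and `ξ(u·ξ(u)) = u·ξ(u)`, and
(b) `u·ξ'(u) = u·ξ(u)`. -/
theorem ad_comp_order_two_iff {A : Type*} [CStarAlgebra A] (ξ : A → A)
    (hbij : Function.Bijective ξ)
    (hadd : ∀ a b : A, ξ (a + b) = ξ a + ξ b)
    (hmul : ∀ a b : A, ξ (a * b) = ξ a * ξ b)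
    (hstar : ∀ a : A, ξ (star a) = star (ξ a))
    (hinvol : ∀ a : A, ξ (ξ a) = a)
    (u : A) (hu : star u * u = 1) (hu' : u * star u = 1) :
    ((∀ a : A, u * ξ (u * ξ a * star u) * star u = a) ↔ u * ξ u ∈ Set.center A) ∧
    (u * ξ u ∈ Set.center A →
      (ξ u * u = u * ξ u ∧ ξ (u * ξ u) = u * ξ u) ∧
      u * (u * ξ u * star u) = u * ξ u) := by
  have hone : ξ 1 = 1 := by
    simpa [hinvol] using (hmul 1 (ξ 1)).symm
  have hunit : u * ξ u ∈ unitary A := by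
    refine mul_mem (Unitary.mem_iff.mpr ⟨hu, hu'⟩) (Unitary.mem_iff.mpr ⟨?_, ?_⟩)
    · rw [← hstar, ← hmul, hu, hone]
    · rw [← hstar, ← hmul, hu', hone]
  have hsq (a : A) : u * ξ (u * ξ a * star u) * star u = u * ξ u * a * star (u * ξ u) := by
    simp only [hmul, hstar, hinvol, star_mul, mul_assoc]
  rw [Semigroup.mem_center_iff]
  refine ⟨⟨fun h a => ?_, fun h a => ?_⟩, fun h => ?_⟩
  · nth_rewrite 1 [← h a]
    rw [hsq, mul_assoc, Unitary.star_mul_self_of_mem hunit, mul_one]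
  · rw [hsq, ← h a, mul_assoc, Unitary.mul_star_self_of_mem hunit, mul_one]
  · have hcomm : ξ u * u = u * ξ u :=
      calc ξ u * u = star u * (u * ξ u) * u := by rw [← mul_assoc, hu, one_mul]
        _ = u * ξ u := by rw [h, mul_assoc, hu, mul_one]
    refine ⟨⟨hcomm, by rw [hmul, hinvol, hcomm]⟩, ?_⟩
    rw [← mul_assoc, h, mul_assoc, hu', mul_one]
end

section
/- Let A be a unital C*-algebra over ℂ, let ξ : A → A be a *-ring automorphism of order two (ξ∘ξ = id), let u ∈ A be a unitary with u·ξ(u) in the center Z(A), and set ξ'(a) = u·ξ(a)·u*. Then: (c) ξ' and ξ commute (ξ'∘ξ = ξ∘ξ') if and only if u² ∈ Z(A); (d) if ξ(z*) = z for all z ∈ Z(A), then (u·ξ(u))² = 1. -/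
/-- Let `ξ` be a *-ring automorphism of order two of a unital C*-algebra and `u` a unitary
with `u·ξ(u)` central; set `ξ'(a) = u·ξ(a)·u*`.  Then (c) `ξ'` and `ξ` commute iff
`u² ∈ Z(A)`, and (d) if `ξ(z*) = z` for all central `z` then `(u·ξ(u))² = 1`. -/
theorem ad_comp_commute_iff_sq_central {A : Type*} [CStarAlgebra A] (ξ : A → A)
    (hbij : Function.Bijective ξ)
    (hadd : ∀ a b : A, ξ (a + b) = ξ a + ξ b)
    (hmul : ∀ a b : A, ξ (a * b) = ξ a * ξ b)
    (hstar : ∀ a : A, ξ (star a) = star (ξ a))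
    (hinvol : ∀ a : A, ξ (ξ a) = a)
    (u : A) (hu : star u * u = 1) (hu' : u * star u = 1)
    (hc : u * ξ u ∈ Set.center A) :
    ((∀ a : A, u * ξ (ξ a) * star u = ξ (u * ξ a * star u)) ↔ u ^ 2 ∈ Set.center A) ∧
    ((∀ z ∈ Set.center A, ξ (star z) = z) → (u * ξ u) ^ 2 = 1) := by
  have h1 : ξ 1 = 1 := by
    obtain ⟨e, he⟩ := hbij.surjective 1
    simpa [he] using (hmul 1 e).symm
  have hv : star (ξ u) * ξ u = 1 := by rw [← hstar, ← hmul, hu, h1]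
  have hv' : ξ u * star (ξ u) = 1 := by rw [← hstar, ← hmul, hu', h1]
  have hcomm : ∀ a : A, u * ξ u * a = a * (u * ξ u) := fun a =>
    (Set.mem_center_iff.1 hc).comm a
  have hconj : ∀ a : A, u * (ξ u * a * star (ξ u)) * u = a * u ^ 2 := fun a => by
    calc u * (ξ u * a * star (ξ u)) * u = (u * ξ u * a) * star (ξ u) * u := by
          simp only [mul_assoc]
      _ = a * u * (ξ u * star (ξ u)) * u := by rw [hcomm]; simp only [mul_assoc]
      _ = a * u ^ 2 := by rw [hv', mul_one, mul_assoc, sq]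
  have hconj' : ∀ a : A, u * (u * a * star u) * u = u ^ 2 * a := fun a => by
    calc u * (u * a * star u) * u = u ^ 2 * a * (star u * u) := by
          simp only [mul_assoc, sq]
      _ = u ^ 2 * a := by rw [hu, mul_one]
  have hcancel : ∀ x y : A, u * x * u = u * y * u → x = y := fun x y h => by
    have hx : ∀ z : A, star u * (u * z * u) * star u = z := fun z => by
      calc star u * (u * z * u) * star u = (star u * u) * z * (u * star u) := by
            simp only [mul_assoc]
        _ = z := by rw [hu, hu', one_mul, mul_one]
    rw [← hx x, h, hx]
  refine ⟨?_, fun h => ?_⟩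
  · simp only [hmul, hstar, hinvol, Semigroup.mem_center_iff]
    refine forall_congr' fun a => ⟨fun h => ?_, fun h => hcancel _ _ ?_⟩
    · rw [← hconj a, ← hconj' a, h]
    · rw [hconj, hconj', h]
  · have hfix : ξ u * u = u * ξ u := by
      calc ξ u * u = star u * (u * ξ u * u) := by
            simp only [← mul_assoc, hu, one_mul]
        _ = u * ξ u := by rw [hcomm u, ← mul_assoc, hu, one_mul]
    have hself : star (u * ξ u) = u * ξ u := by
      simpa only [hstar, hmul, hinvol, hfix] using h _ hc
    calc (u * ξ u) ^ 2 = star (u * ξ u) * (u * ξ u) := by rw [hself, sq]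
      _ = star (ξ u) * (star u * u) * ξ u := by rw [star_mul]; simp only [mul_assoc]
      _ = 1 := by rw [hu, mul_one, hv]
end

section
/- Let A be a unital C*-algebra over ℂ and let γ be a grading on A (a ℂ-linear *-algebra automorphism with γ∘γ = id) which fixes the center Z(A) pointwise. Let u ∈ A be a unitary. Then Ad_u∘γ = γ∘Ad_u if and only if u is locally homogeneous, i.e. u·γ(u*) lies in Z(A) and (u·γ(u*))² = 1. -/
/-- Let `γ` be a grading of a unital C*-algebra which fixes the center pointwise, and let
`u` be a unitary.  Then `Ad_u ∘ γ = γ ∘ Ad_u` if and only if `u` is locally homogeneous,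
i.e. `u·γ(u*)` is central and `(u·γ(u*))² = 1`. -/
theorem ad_commutes_with_grading_iff_locally_homogeneous {A : Type*} [CStarAlgebra A]
    (γ : A → A)
    (hadd : ∀ a b : A, γ (a + b) = γ a + γ b)
    (hmul : ∀ a b : A, γ (a * b) = γ a * γ b)
    (hstar : ∀ a : A, γ (star a) = star (γ a))
    (hsmul : ∀ (c : ℂ) (a : A), γ (c • a) = c • γ a)
    (hinvol : ∀ a : A, γ (γ a) = a)
    (hcenter : ∀ z ∈ Set.center A, γ z = z)
    (u : A) (hu : star u * u = 1) (hu' : u * star u = 1) :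
    (∀ a : A, u * γ a * star u = γ (u * a * star u)) ↔
      (u * γ (star u) ∈ Set.center A ∧ (u * γ (star u)) ^ 2 = 1) := by
  have hone : γ 1 = 1 := by
    calc γ 1 = γ 1 * γ (γ 1) := by rw [hinvol, mul_one]
      _ = 1 := by rw [← hmul, one_mul, hinvol]
  have hvw : γ (star u) * γ u = 1 := by rw [← hmul, hu, hone]
  constructor
  · intro h
    have hAd : ∀ a : A, u * a * star u = γ u * a * γ (star u) := by
      intro a
      have := h (γ a)
      rwa [hmul, hmul, hinvol] at this
    have hcomm : ∀ a : A, γ (star u) * u * a = a * (γ (star u) * u) := by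
      intro a
      calc γ (star u) * u * a = γ (star u) * (u * a * star u) * u := by
            simp only [mul_assoc, hu, mul_one]
        _ = γ (star u) * γ u * (a * (γ (star u) * u)) := by
            rw [hAd]; simp only [mul_assoc]
        _ = a * (γ (star u) * u) := by rw [hvw, one_mul]
    have heq : u * γ (star u) = γ (star u) * u := by
      calc u * γ (star u) = u * (γ (star u) * u) * star u := by
            simp only [mul_assoc, hu', mul_one]
        _ = γ (star u) * u := by rw [← hcomm, mul_assoc, hu', mul_one]
    have hz : u * γ (star u) ∈ Set.center A := by
      rw [Semigroup.mem_center_iff, heq]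
      exact fun a => (hcomm a).symm
    refine ⟨hz, ?_⟩
    have hfix : γ u * star u = u * γ (star u) := by
      have := hcenter _ hz
      rwa [hmul, hinvol] at this
    calc (u * γ (star u)) ^ 2 = u * γ (star u) * (γ u * star u) := by rw [hfix, sq]
      _ = u * (γ (star u) * γ u) * star u := by simp only [mul_assoc]
      _ = 1 := by rw [hvw, mul_one, hu']
  · rintro ⟨hz, hsq⟩ a
    have hcomm := Semigroup.mem_center_iff.mp hz
    have hv : γ (star u) = star u * (u * γ (star u)) := by rw [← mul_assoc, hu, one_mul]
    have hw : γ u = u * γ (star u) * u := by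
      calc γ u = (u * γ (star u)) ^ 2 * γ u := by rw [hsq, one_mul]
        _ = u * γ (star u) * (u * (γ (star u) * γ u)) := by simp only [sq, mul_assoc]
        _ = u * γ (star u) * u := by rw [hvw, mul_one]
    symm
    calc γ (u * a * star u) = γ u * γ a * γ (star u) := by rw [hmul, hmul]
      _ = u * γ (star u) * u * γ a * (star u * (u * γ (star u))) := by rw [← hw, ← hv]
      _ = u * γ (star u) * (u * γ a * star u * (u * γ (star u))) := by simp only [mul_assoc]
      _ = (u * γ (star u)) ^ 2 * (u * γ a * star u) := by rw [hcomm, sq]; simp only [mul_assoc]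
      _ = u * γ a * star u := by rw [hsq, one_mul]
end

section
/- Let A be a unital C*-algebra over ℂ with trivial center (every element of the center of A is a complex scalar multiple of 1). Let γ be a grading on A, and let ℛ and 𝔰 be real structures on A which each commute with γ. Suppose u ∈ A is a unitary with 𝔰(a) = u·ℛ(a)·u* for all a ∈ A. Then there exist signs ε, ε' ∈ {1, −1} such that u·ℛ(u) = ε·1 and u·γ(u)* = ε'·1; moreover, for every other unitary v with 𝔰(a) = v·ℛ(a)·v* for all a, one has v·ℛ(v) = ε·1 and v·γ(v)* = ε'·1 with the same signs. (The relative signs η = (φ_ℛ(u), φ_{γ*}(u)) are well defined and take values ±1.) -/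
/-- In a complex star algebra with trivial center, two unitaries implementing the same inner
automorphism differ by a phase. -/
theorem exists_phase_of_conj_eq {A : Type*} [CStarAlgebra A] [Nontrivial A]
    (hcenter : ∀ z ∈ Set.center A, ∃ c : ℂ, z = c • (1 : A))
    {u v : A} (hu : star u * u = 1) (hu' : u * star u = 1) (hv : star v * v = 1)
    (h : ∀ a : A, u * a * star u = v * a * star v) :
    ∃ c : ℂ, c * (starRingEnd ℂ) c = 1 ∧ v = c • u := by
  have hcomm : ∀ a, (star u * v) * a = a * (star u * v) := fun a => by
    calc (star u * v) * a = star u * (v * a * (star v * v)) := by rw [hv]; simp only [mul_one, mul_assoc]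
      _ = star u * (v * a * star v) * v := by simp only [mul_assoc]
      _ = (star u * u) * a * (star u * v) := by rw [← h]; simp only [mul_assoc]
      _ = a * (star u * v) := by rw [hu, one_mul]
  obtain ⟨c, hc⟩ := hcenter (star u * v)
    (Semigroup.mem_center_iff.2 fun a => (hcomm a).symm)
  have hvu : v = c • u := by
    calc v = u * (star u * v) := by rw [← mul_assoc, hu', one_mul]
      _ = c • u := by rw [hc, mul_smul_comm, mul_one]
  refine ⟨c, ?_, hvu⟩
  rw [hvu, star_smul, smul_mul_smul_comm, hu] at hv
  have : (star c * c) • (1 : A) = (1 : ℂ) • (1 : A) := by rw [hv, one_smul]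
  rw [mul_comm]
  exact smul_left_injective ℂ one_ne_zero this


/-- In a unital C*-algebra with trivial center, given a grading `γ` and two real structures
`ℛ`, `𝔰` commuting with `γ` that are inner related via a unitary generator `u`
(`𝔰 = Ad_u ∘ ℛ`), the relative signs `(u·ℛ(u), u·γ(u)*)` are well defined scalars `±1`,
independent of the choice of generator. -/
theorem relative_signs_well_defined {A : Type*} [CStarAlgebra A]
    (hcenter : ∀ z ∈ Set.center A, ∃ c : ℂ, z = c • (1 : A))
    (γ : A → A)
    (hγadd : ∀ a b : A, γ (a + b) = γ a + γ b)
    (hγmul : ∀ a b : A, γ (a * b) = γ a * γ b)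
    (hγstar : ∀ a : A, γ (star a) = star (γ a))
    (hγsmul : ∀ (c : ℂ) (a : A), γ (c • a) = c • γ a)
    (hγinvol : ∀ a : A, γ (γ a) = a)
    (ℛ 𝔰 : A → A)
    (hRadd : ∀ a b : A, ℛ (a + b) = ℛ a + ℛ b)
    (hRmul : ∀ a b : A, ℛ (a * b) = ℛ a * ℛ b)
    (hRstar : ∀ a : A, ℛ (star a) = star (ℛ a))
    (hRsmul : ∀ (c : ℂ) (a : A), ℛ (c • a) = (starRingEnd ℂ) c • ℛ a)
    (hRinvol : ∀ a : A, ℛ (ℛ a) = a)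
    (hRγ : ∀ a : A, ℛ (γ a) = γ (ℛ a))
    (hSadd : ∀ a b : A, 𝔰 (a + b) = 𝔰 a + 𝔰 b)
    (hSmul : ∀ a b : A, 𝔰 (a * b) = 𝔰 a * 𝔰 b)
    (hSstar : ∀ a : A, 𝔰 (star a) = star (𝔰 a))
    (hSsmul : ∀ (c : ℂ) (a : A), 𝔰 (c • a) = (starRingEnd ℂ) c • 𝔰 a)
    (hSinvol : ∀ a : A, 𝔰 (𝔰 a) = a)
    (hSγ : ∀ a : A, 𝔰 (γ a) = γ (𝔰 a))
    (u : A) (hu : star u * u = 1) (hu' : u * star u = 1)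
    (hgen : ∀ a : A, 𝔰 a = u * ℛ a * star u) :
    ∃ ε ε' : ℂ, (ε = 1 ∨ ε = -1) ∧ (ε' = 1 ∨ ε' = -1) ∧
      u * ℛ u = ε • (1 : A) ∧ u * star (γ u) = ε' • (1 : A) ∧
      ∀ v : A, star v * v = 1 → v * star v = 1 → (∀ a : A, 𝔰 a = v * ℛ a * star v) →
        v * ℛ v = ε • (1 : A) ∧ v * star (γ v) = ε' • (1 : A) := by
  rcases subsingleton_or_nontrivial A with _ | _
  · exact ⟨1, 1, .inl rfl, .inl rfl, Subsingleton.elim _ _, Subsingleton.elim _ _,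
      fun _ _ _ _ => ⟨Subsingleton.elim _ _, Subsingleton.elim _ _⟩⟩
  have hinj : ∀ {x : A}, x ≠ 0 → ∀ {c d : ℂ}, c • x = d • x → c = d :=
    fun hx _ _ h => smul_left_injective ℂ hx h
  have hu0 : u ≠ 0 := by
    rintro rfl
    simp at hu
  have hR1 : ℛ 1 = 1 := by
    have h := hRmul 1 (ℛ 1)
    rw [one_mul, hRinvol, mul_one] at h
    exact h.symm
  have hγ1 : γ 1 = 1 := by
    have h := hγmul 1 (γ 1)
    rw [one_mul, hγinvol, mul_one] at h
    exact h.symm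
  have hRu : star (ℛ u) * ℛ u = 1 := by rw [← hRstar, ← hRmul, hu, hR1]
  have hγu : star (γ u) * γ u = 1 := by rw [← hγstar, ← hγmul, hu, hγ1]
  obtain ⟨ε, hε, hw⟩ := exists_phase_of_conj_eq hcenter (u := 1) (v := u * ℛ u)
    (by simp) (by simp)
    (by rw [star_mul, mul_assoc, ← mul_assoc (star u), hu, one_mul, hRu])
    (fun a => by
      have h := hSinvol a
      rw [hgen, hgen, hRmul, hRmul, hRinvol, hRstar] at h
      rw [star_one, mul_one, one_mul, star_mul]
      simp only [mul_assoc] at h ⊢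
      exact h.symm)
  obtain ⟨d, hd, hγd⟩ := exists_phase_of_conj_eq hcenter hu hu' hγu
    (fun a => by
      have h := hSγ (ℛ (γ a))
      rw [hgen, hgen, hRγ, hRinvol, hγinvol, hγmul, hγmul, hγstar,
        hγinvol] at h
      exact h)
  have hεreal : (starRingEnd ℂ) ε = ε := by
    have h1 : ℛ u * u = (starRingEnd ℂ) ε • (1 : A) := by
      rw [← hR1, ← hRsmul, ← hw, hRmul, hRinvol]
    refine hinj (one_ne_zero (α := A)) ?_
    calc (starRingEnd ℂ) ε • (1 : A) = u * (ℛ u * u) * star u := by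
          rw [h1, mul_smul_comm, smul_mul_assoc, mul_one, hu']
      _ = u * ℛ u * (u * star u) := by simp only [mul_assoc]
      _ = ε • (1 : A) := by rw [hu', mul_one, hw]
  rw [hεreal] at hε
  have hdd : d * d = 1 := by
    refine hinj hu0 ?_
    rw [mul_smul, ← hγd, ← hγsmul, ← hγd, hγinvol, one_smul]
  have hdreal : (starRingEnd ℂ) d = d := by
    rcases mul_self_eq_one_iff.1 hdd with rfl | rfl <;> simp
  have hγu' : u * star (γ u) = d • (1 : A) := by
    rw [hγd, star_smul, mul_smul_comm, hu', ← starRingEnd_apply, hdreal]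
  refine ⟨ε, d, mul_self_eq_one_iff.1 hε, mul_self_eq_one_iff.1 hdd, hw, hγu', ?_⟩
  intro v hv _ hgv
  obtain ⟨c, hc, rfl⟩ := exists_phase_of_conj_eq hcenter hu hu' hv
    (fun a => by
      have h := hgv (ℛ a)
      rwa [hgen, hRinvol] at h)
  constructor
  · rw [hRsmul, smul_mul_smul_comm, hc, one_smul, hw]
  · rw [hγsmul, star_smul, smul_mul_smul_comm, ← starRingEnd_apply, hc, one_smul, hγu']
end

section
/- Let A be a unital C*-algebra over ℂ with trivial center (every element of the center of A is a complex scalar multiple of 1). Let ℛ be a real structure on A and let u ∈ A be a unitary such that 𝔰 := Ad_u∘ℛ (i.e. 𝔰(a) = u·ℛ(a)·u*) is again a real structure. Then the following are equivalent: (1) there exists a unitary v ∈ A with ℛ(v) = v and 𝔰(a) = v·ℛ(a)·v* for all a ∈ A; (2) ℛ and 𝔰 commute, i.e. ℛ(𝔰(a)) = 𝔰(ℛ(a)) for all a ∈ A. -/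
/-- A complex number `c` of norm one is `l / conj l` for some `l` of norm one. -/
lemma Complex.exists_unit_conj_mul_eq {c : ℂ} (hc : starRingEnd ℂ c * c = 1) :
    ∃ l : ℂ, starRingEnd ℂ l * l = 1 ∧ starRingEnd ℂ l * c = l := by
  obtain ⟨l, rfl⟩ := IsAlgClosed.exists_pow_nat_eq c (n := 2) (by norm_num)
  have hnorm : ‖l‖ = 1 := by
    have h := congrArg norm hc
    simp only [norm_mul, norm_pow, RCLike.norm_conj, norm_one] at h
    rw [← pow_add] at h
    exact (pow_eq_one_iff_of_nonneg (norm_nonneg l) (by norm_num)).1 h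
  have hl : starRingEnd ℂ l * l = 1 := by
    rw [Complex.conj_mul', hnorm]
    norm_num
  exact ⟨l, hl, by rw [sq, ← mul_assoc, hl, one_mul]⟩

/-- If two unitaries implement the same inner automorphism, then `star u * w` is central. -/
lemma star_mul_mem_center_of_conj_eq {A : Type*} [Ring A] [StarRing A] {u w : A}
    (hu : star u * u = 1) (hw : star w * w = 1)
    (h : ∀ a : A, w * a * star w = u * a * star u) : star u * w ∈ Set.center A := by
  rw [Semigroup.mem_center_iff]
  intro a
  calc a * (star u * w) = star u * u * a * star u * w := by rw [hu, one_mul, mul_assoc]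
    _ = star u * (u * a * star u) * w := by simp only [mul_assoc]
    _ = star u * (w * a * star w) * w := by rw [h]
    _ = star u * w * a * (star w * w) := by simp only [mul_assoc]
    _ = star u * w * a := by rw [hw, mul_one]


/-- In a unital C*-algebra with trivial center, let `ℛ` be a real structure and `u` a
unitary such that `𝔰 := Ad_u ∘ ℛ` is again a real structure (i.e. has order two).
Then there exists an `ℛ`-invariant unitary generator for `𝔰 ∘ ℛ` if and only if
`ℛ` and `𝔰` commute. -/
theorem invariant_generator_iff_commute {A : Type*} [CStarAlgebra A]
    (hcenter : ∀ z ∈ Set.center A, ∃ c : ℂ, z = c • (1 : A))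
    (ℛ : A → A)
    (hRadd : ∀ a b : A, ℛ (a + b) = ℛ a + ℛ b)
    (hRmul : ∀ a b : A, ℛ (a * b) = ℛ a * ℛ b)
    (hRstar : ∀ a : A, ℛ (star a) = star (ℛ a))
    (hRsmul : ∀ (c : ℂ) (a : A), ℛ (c • a) = (starRingEnd ℂ) c • ℛ a)
    (hRinvol : ∀ a : A, ℛ (ℛ a) = a)
    (u : A) (hu : star u * u = 1) (hu' : u * star u = 1)
    (hS2 : ∀ a : A, u * ℛ (u * ℛ a * star u) * star u = a) :
    (∃ v : A, (star v * v = 1 ∧ v * star v = 1) ∧ ℛ v = v ∧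
        ∀ a : A, u * ℛ a * star u = v * ℛ a * star v) ↔
    (∀ a : A, ℛ (u * ℛ a * star u) = u * ℛ (ℛ a) * star u) := by
  constructor
  · rintro ⟨v, -, hv, h⟩ a
    rw [h, h, hRmul, hRmul, hRstar, hv]
  · intro h
    rcases subsingleton_or_nontrivial A with hA | hA
    · exact ⟨u, ⟨hu, hu'⟩, Subsingleton.elim _ _, fun _ ↦ rfl⟩
    have hR1 : ℛ 1 = 1 := by
      simpa [hRinvol] using (hRmul (ℛ 1) 1).symm
    have hw : star (ℛ u) * ℛ u = 1 := by rw [← hRstar, ← hRmul, hu, hR1]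
    have hconj (a : A) : ℛ u * a * star (ℛ u) = u * a * star u := by
      simpa only [hRmul, hRstar, hRinvol] using h a
    obtain ⟨c, hc⟩ := hcenter _ (star_mul_mem_center_of_conj_eq hu hw hconj)
    have hRu : ℛ u = c • u := by
      rw [← one_mul (ℛ u), ← hu', mul_assoc, hc, mul_smul_comm, mul_one]
    have hu0 : u ≠ 0 := by
      rintro rfl
      simp at hu
    have hcc : starRingEnd ℂ c * c = 1 := by
      refine smul_left_injective ℂ hu0 ?_
      simpa only [hRu, hRsmul, smul_smul, one_smul] using hRinvol u
    obtain ⟨l, hl, hlc⟩ := Complex.exists_unit_conj_mul_eq hcc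
    have hl' : l * star l = 1 := by rw [mul_comm]; exact hl
    refine ⟨l • u, ⟨?_, ?_⟩, ?_, fun a ↦ ?_⟩
    · rw [star_smul, smul_mul_smul_comm, hu, mul_comm, hl', one_smul]
    · rw [star_smul, smul_mul_smul_comm, hu', hl', one_smul]
    · rw [hRsmul, hRu, smul_smul, hlc]
    · rw [star_smul, smul_mul_assoc, smul_mul_smul_comm, hl', one_smul]
end

section
/- Let A be a unital C*-algebra over ℂ, γ a grading on A, and 𝔣 a real structure on A commuting with γ. Let Θ ∈ A be a unitary such that γ(Θ) = Θ (Θ is even), Θ·𝔣(Θ) = 1 (relative sign +1), and there exists z ∈ ℂ with |z| = 1 and z not in the spectrum of Θ. Then there exists a unitary w ∈ A with w² = Θ, γ(w) = w and 𝔣(w*) = w; consequently the real structure ℛ := Ad_Θ∘𝔣 (that is, ℛ(a) = Θ·𝔣(a)·Θ*) satisfies ℛ(a) = w·𝔣(w* a w)·w* for all a ∈ A, i.e. ℛ is inner conjugate to 𝔣. (The case η_{ℛ,𝔣} = (+1,+1) of the classification theorem: (A, γ, ℛ) is inner conjugate to (A, γ, 𝔣).) -/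
open scoped CStarAlgebra in
/-- A conjugate-linear multiplicative star-preserving bijection sending `a` to `star a` sends
`star (f(a))` to `f(a)` for every continuous function `f` on the spectrum of `a`. -/
lemma conjLinear_map_star_cfc {A : Type*} [CStarAlgebra A] (r : A → A)
    (hone : r 1 = 1)
    (hadd : ∀ a b : A, r (a + b) = r a + r b)
    (hmul : ∀ a b : A, r (a * b) = r a * r b)
    (hstar : ∀ a : A, r (star a) = star (r a))
    (hsmul : ∀ (c : ℂ) (a : A), r (c • a) = (starRingEnd ℂ) c • r a)
    {a : A} (ha : IsStarNormal a) (hra : r a = star a)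
    {f : ℂ → ℂ} (hf : ContinuousOn f (spectrum ℂ a)) :
    r (star (cfc f a)) = cfc f a := by
  let ψ : C(spectrum ℂ a, ℂ) →⋆ₐ[ℂ] A :=
    { toFun := fun g ↦ r (cfcHom ha (star g))
      map_one' := by simp [hone]
      map_mul' := fun g h ↦ by rw [star_mul, mul_comm, map_mul, hmul]
      map_zero' := by
        have h : r 0 = 0 := by simpa using hadd 0 0
        simp [h]
      map_add' := fun g h ↦ by rw [star_add, map_add, hadd]
      commutes' := fun c ↦ by
        rw [Algebra.algebraMap_eq_smul_one, Algebra.algebraMap_eq_smul_one, star_smul, star_one,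
          map_smul, map_one, hsmul, hone]
        simp
      map_star' := fun g ↦ by rw [map_star, hstar] }
  have hψ : cfcHom ha = ψ := by
    refine cfcHom_eq_of_continuous_of_map_id ha ψ (map_continuous ψ) ?_
    change r (cfcHom ha (star _)) = a
    rw [map_star, cfcHom_id, hstar, hra, star_star]
  rw [cfc_apply f a ha hf, ← map_star]
  exact congr($hψ _).symm

/-- A unit complex number other than `-1` lies in the slit plane. -/
lemma mem_slitPlane_of_norm_eq_one {y : ℂ} (hy : ‖y‖ = 1) (hy' : y ≠ -1) :
    y ∈ Complex.slitPlane := by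
  by_contra h
  simp only [Complex.mem_slitPlane_iff, not_or, not_lt, not_not] at h
  have h1 : y.re * y.re + y.im * y.im = 1 := by
    rw [← Complex.normSq_apply, Complex.normSq_eq_norm_sq, hy, one_pow]
  refine hy' (Complex.ext ?_ ?_)
  · simp only [Complex.neg_re, Complex.one_re]
    rw [h.2] at h1
    nlinarith [h.1]
  · simp [h.2]

/-- There is a square root function continuous on the unit circle away from a given point. -/
lemma exists_continuousOn_sqrt_circle {z : ℂ} (hz : ‖z‖ = 1) :
    ∃ g : ℂ → ℂ, ContinuousOn g (Metric.sphere 0 1 \ {z}) ∧ ∀ x, g x ^ 2 = x := by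
  have hz0 : -z ≠ 0 := by
    rw [← norm_ne_zero_iff, norm_neg, hz]
    exact one_ne_zero
  refine ⟨fun x ↦ (-z) ^ (2⁻¹ : ℂ) * ((-z)⁻¹ * x) ^ (2⁻¹ : ℂ), ?_, fun x ↦ ?_⟩
  · refine continuousOn_const.mul ((by fun_prop : Continuous fun x : ℂ ↦
      (-z)⁻¹ * x).continuousOn.cpow_const fun x hx ↦ mem_slitPlane_of_norm_eq_one ?_ fun h ↦ hx.2 ?_)
    · have : ‖x‖ = 1 := by simpa using hx.1
      rw [norm_mul, norm_inv, norm_neg, hz, this, inv_one, one_mul]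
    · rw [inv_mul_eq_iff_eq_mul₀ hz0] at h
      simpa using h
  · rw [mul_pow, Complex.cpow_ofNat_inv_pow, Complex.cpow_ofNat_inv_pow,
      mul_inv_cancel_left₀ hz0]

/-- A multiplicative involution of a monoid preserves the unit. -/
lemma map_one_of_mul_of_involutive {M : Type*} [Monoid M] {r : M → M}
    (hmul : ∀ a b, r (a * b) = r a * r b) (hinv : Function.Involutive r) : r 1 = 1 := by
  simpa [hinv 1] using (hmul 1 (r 1)).symm


/-- The case `η = (+1,+1)`: if `Θ` is an even unitary with `Θ·𝔣(Θ) = 1` and a gap in its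
spectrum, then `Θ` has an even square root `w` with `𝔣(w*) = w`, and consequently the
real structure `ℛ = Ad_Θ ∘ 𝔣` is inner conjugate to `𝔣`. -/
theorem sign_plus_plus_inner_conjugate {A : Type*} [CStarAlgebra A]
    (γ : A → A)
    (hγadd : ∀ a b : A, γ (a + b) = γ a + γ b)
    (hγmul : ∀ a b : A, γ (a * b) = γ a * γ b)
    (hγstar : ∀ a : A, γ (star a) = star (γ a))
    (hγsmul : ∀ (c : ℂ) (a : A), γ (c • a) = c • γ a)
    (hγinvol : ∀ a : A, γ (γ a) = a)
    (𝔣 : A → A)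
    (hfadd : ∀ a b : A, 𝔣 (a + b) = 𝔣 a + 𝔣 b)
    (hfmul : ∀ a b : A, 𝔣 (a * b) = 𝔣 a * 𝔣 b)
    (hfstar : ∀ a : A, 𝔣 (star a) = star (𝔣 a))
    (hfsmul : ∀ (c : ℂ) (a : A), 𝔣 (c • a) = (starRingEnd ℂ) c • 𝔣 a)
    (hfinvol : ∀ a : A, 𝔣 (𝔣 a) = a)
    (hfγ : ∀ a : A, 𝔣 (γ a) = γ (𝔣 a))
    (Θ : A) (hΘ : star Θ * Θ = 1) (hΘ' : Θ * star Θ = 1)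
    (hΘeven : γ Θ = Θ)
    (hsign : Θ * 𝔣 Θ = 1)
    (hgap : ∃ z : ℂ, ‖z‖ = 1 ∧ z ∉ spectrum ℂ Θ) :
    ∃ w : A, (star w * w = 1 ∧ w * star w = 1) ∧ w ^ 2 = Θ ∧ γ w = w ∧ 𝔣 (star w) = w ∧
      ∀ a : A, Θ * 𝔣 a * star Θ = w * 𝔣 (star w * a * w) * star w := by
  obtain ⟨z, hz, hzΘ⟩ := hgap
  obtain ⟨g, hg, hg2⟩ := exists_continuousOn_sqrt_circle hz
  have hu : Θ ∈ unitary A := ⟨hΘ, hΘ'⟩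
  have hn : IsStarNormal Θ := ⟨hΘ.trans hΘ'.symm⟩
  have hsphere := spectrum.subset_circle_of_unitary (𝕜 := ℂ) hu
  have hgc : ContinuousOn g (spectrum ℂ Θ) :=
    hg.mono fun x hx ↦ ⟨hsphere hx, fun h ↦ hzΘ (Set.mem_singleton_iff.mp h ▸ hx)⟩
  have hwu : cfc g Θ ∈ unitary A := by
    rw [cfc_unitary_iff g Θ]
    intro x hx
    have hx1 : ‖x‖ = 1 := by simpa using hsphere hx
    have h2 : ‖g x‖ ^ 2 = 1 := by rw [← norm_pow, hg2, hx1]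
    rw [Complex.star_def, Complex.conj_mul']
    exact_mod_cast h2
  have hw2 : cfc g Θ ^ 2 = Θ := by
    rw [← cfc_pow g 2 Θ]
    simp only [hg2]
    exact cfc_id' ℂ Θ
  have hf1 : 𝔣 1 = 1 := map_one_of_mul_of_involutive hfmul hfinvol
  have hγ1 : γ 1 = 1 := map_one_of_mul_of_involutive hγmul hγinvol
  have hfΘ : 𝔣 Θ = star Θ := (left_inv_eq_right_inv hΘ hsign).symm
  have hfw : 𝔣 (star (cfc g Θ)) = cfc g Θ :=
    conjLinear_map_star_cfc 𝔣 hf1 hfadd hfmul hfstar hfsmul hn hfΘ hgc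
  open scoped CStarAlgebra in
  have hγw : γ (cfc g Θ) = cfc g Θ := by
    let φ : A →⋆ₐ[ℂ] A :=
      { toFun := γ
        map_one' := hγ1
        map_mul' := hγmul
        map_zero' := by simpa using hγadd 0 0
        map_add' := hγadd
        commutes' := fun c ↦ by
          rw [Algebra.algebraMap_eq_smul_one, hγsmul, hγ1]
        map_star' := hγstar }
    have hφΘ : φ Θ = Θ := hΘeven
    have h := φ.map_cfc g Θ hgc (map_continuous φ) hn (hφΘ.symm ▸ hn)
    rwa [hφΘ] at h
  refine ⟨cfc g Θ, hwu, hw2, hγw, hfw, fun a ↦ ?_⟩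
  have hfw' : 𝔣 (cfc g Θ) = star (cfc g Θ) := by
    rw [← hfw, hfinvol, hfw]
  rw [hfmul, hfmul, hfw, hfw']
  nth_rewrite 1 2 [← hw2]
  simp only [pow_two, star_mul, mul_assoc]
end

section
/- Let A be a unital C*-algebra over ℂ, Γ ∈ A a self-adjoint unitary, and ℛ : A → A an additive, multiplicative, star-preserving, conjugate-linear map with ℛ(Γ) = −Γ and ℛ(1) = 1 (e.g. a real structure for which the inner grading Ad_Γ is imaginary inner). Let U = (1/2)·[[1+Γ, 1−Γ],[1−Γ, 1+Γ]] ∈ M₂(A) and let ℛ₂ denote ℛ applied entrywise on M₂(A). Then U·ℛ₂(U) = [[0,1],[1,0]]; in particular U·ℛ₂(U*) = 1⊗σ_x, so conjugation by U carries the entrywise real structure ℛ₂ on M₂(A) to Ad_{1⊗σ_x}∘ℛ₂. -/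
open Matrix

/-- If `ℛ` is a conjugate-linear multiplicative star-preserving map with `ℛ(Γ) = −Γ`
(imaginary inner grading) and `ℛ(1) = 1`, then for
`U = (1/2)·[[1+Γ, 1−Γ],[1−Γ, 1+Γ]]` one has `U·ℛ₂(U) = 1⊗σ_x`, where `ℛ₂` acts
entrywise; in particular `U·ℛ₂(U*) = 1⊗σ_x`. -/
theorem U_mul_R2_U_eq_sigma_x {A : Type*} [CStarAlgebra A]
    (Γ : A) (hΓ_sa : star Γ = Γ) (hΓ_sq : Γ ^ 2 = 1)
    (ℛ : A → A)
    (hRadd : ∀ a b : A, ℛ (a + b) = ℛ a + ℛ b)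
    (hRmul : ∀ a b : A, ℛ (a * b) = ℛ a * ℛ b)
    (hRstar : ∀ a : A, ℛ (star a) = star (ℛ a))
    (hRsmul : ∀ (c : ℂ) (a : A), ℛ (c • a) = (starRingEnd ℂ) c • ℛ a)
    (hRΓ : ℛ Γ = -Γ) (hRone : ℛ (1 : A) = 1) :
    let U : Matrix (Fin 2) (Fin 2) A :=
      ((1 : ℂ) / 2) • !![1 + Γ, 1 - Γ; 1 - Γ, 1 + Γ]
    U * U.map ℛ = !![(0 : A), 1; 1, 0] ∧
      U * (star U).map ℛ = !![(0 : A), 1; 1, 0] := by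
  intro U
  have hneg : ∀ a : A, ℛ (-a) = -ℛ a := fun a => by
    simpa using hRsmul (-1) a
  have hadj : star U = U := by
    ext i j
    fin_cases i <;> fin_cases j <;> simp [U, Matrix.star_apply, hΓ_sa]
  have hmap : U.map ℛ = ((1 : ℂ) / 2) • !![1 - Γ, 1 + Γ; 1 + Γ, 1 - Γ] := by
    ext i j
    fin_cases i <;> fin_cases j <;>
      simp [U, hRsmul, hRadd, hRone, hRΓ, hneg, sub_eq_add_neg, Complex.conj_ofNat]
  have hdiag : (1 + Γ) * (1 - Γ) + (1 - Γ) * (1 + Γ) = 0 := by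
    calc
      _ = 2 • (1 - Γ ^ 2) := by noncomm_ring
      _ = 0 := by simp [hΓ_sq]
  have hoff : (1 + Γ) * (1 + Γ) + (1 - Γ) * (1 - Γ) = (4 : ℂ) • 1 := by
    calc
      _ = 2 • (1 + Γ ^ 2) := by noncomm_ring
      _ = (4 : ℂ) • 1 := by rw [hΓ_sq]; module
  have hdiag' : (1 - Γ) * (1 + Γ) + (1 + Γ) * (1 - Γ) = 0 := by rw [add_comm, hdiag]
  have hoff' : (1 - Γ) * (1 - Γ) + (1 + Γ) * (1 + Γ) = (4 : ℂ) • 1 := by rw [add_comm, hoff]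
  have hmul : U * U.map ℛ = !![(0 : A), 1; 1, 0] := by
    rw [hmap, smul_mul_smul_comm, Matrix.mul_fin_two, hdiag, hdiag', hoff, hoff']
    ext i j
    fin_cases i <;> fin_cases j <;> simp [smul_smul] <;> norm_num
  exact ⟨hmul, by rw [hadj, hmul]⟩
end

section
/- For all natural numbers r and s there is an ℝ-algebra isomorphism Φ : M₂(ℝ) ⊗[ℝ] Cl_{r,s} → Cl_{r+1,s+1} (ordinary, ungraded tensor product) which is graded with respect to the grading Ad_{σ_z} ⊗ involute on the left and the grade involution on the right, i.e. Φ((σ_z m σ_z) ⊗ involute(x)) = involute(Φ(m ⊗ x)) for all m ∈ M₂(ℝ) and x ∈ Cl_{r,s}, where σ_z = [[1,0],[0,−1]]. In other words, (M₂(ℝ) ⊗ Cl_{r,s}, Ad_{σ_z} ⊗ st) ≅ (Cl_{r+1,s+1}, st) as graded real algebras. -/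
open scoped TensorProduct
open CliffordAlgebra

/-- The quadratic form `Q_{r,s}(x,y) = Σ xᵢ² − Σ yⱼ²` on `(Fin r → ℝ) × (Fin s → ℝ)`,
whose Clifford algebra is `Cl_{r,s}`. -/
noncomputable def Qform (r s : ℕ) : QuadraticForm ℝ ((Fin r → ℝ) × (Fin s → ℝ)) :=
  (QuadraticMap.weightedSumSquares ℝ (fun _ : Fin r => (1 : ℝ))).prod
    (QuadraticMap.weightedSumSquares ℝ (fun _ : Fin s => (-1 : ℝ)))

/-- `σ_z = [[1,0],[0,−1]]`. -/
def sigmaZ : Matrix (Fin 2) (Fin 2) ℝ := !![1, 0; 0, -1]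

section MatrixLift

variable {R A : Type*} [CommRing R] [Invertible (2 : R)] [Ring A] [Algebra R A]

/-- The algebra morphism out of `2 × 2` matrices sending `[[0,1],[1,0]]` to `e` and
`[[0,1],[-1,0]]` to `f`, where `e² = 1`, `f² = -1` and `e`, `f` anticommute. -/
def matrixLift (e f : A) (he : e * e = 1) (hf : f * f = -1) (hef : e * f = -(f * e)) :
    Matrix (Fin 2) (Fin 2) R →ₐ[R] A :=
  AlgHom.ofLinearMap
    { toFun := fun m => (⅟2 * (m 0 0 + m 1 1) : R) • (1 : A) +
        (⅟2 * (m 0 0 - m 1 1) : R) • (f * e) +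
        (⅟2 * (m 0 1 + m 1 0) : R) • e + (⅟2 * (m 0 1 - m 1 0) : R) • f
      map_add' := fun m n => by simp only [Matrix.add_apply]; module
      map_smul' := fun c m => by
        simp only [Matrix.smul_apply, smul_eq_mul, RingHom.id_apply]; module }
    (by simp [one_add_one_eq_two])
    (by
      intro m n
      have h1 : f * e * e = f := by rw [mul_assoc, he, mul_one]
      have h2 : e * (f * e) = -f := by rw [← mul_assoc, hef, neg_mul, h1]
      have h3 : f * (f * e) = -e := by rw [← mul_assoc, hf, neg_one_mul]
      have h4 : f * e * f = e := by rw [mul_assoc, hef, mul_neg, h3, neg_neg]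
      have h5 : f * e * (f * e) = 1 := by rw [← mul_assoc, h4, he]
      have h22 : (⅟2 : R) * 2 = 1 := invOf_mul_self 2
      simp only [LinearMap.coe_mk, AddHom.coe_mk, Matrix.mul_apply, Fin.sum_univ_two, mul_add,
        add_mul, smul_mul_smul_comm, mul_one, one_mul, he, hf, hef, h1, h2, h3, h4, h5, smul_neg]
      match_scalars <;> grind)

end MatrixLift

namespace CliffordAlgebra

section AddPlane

variable {R M : Type*} [CommRing R] [AddCommGroup M] [Module R M] (Q : QuadraticForm R M)

/-- The orthogonal sum of `Q` with the hyperbolic plane `x² - y²`. -/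
abbrev addPlane : QuadraticForm R (M × R × R) :=
  Q.prod ((QuadraticMap.sq (R := R)).prod (-QuadraticMap.sq (R := R)))

namespace addPlane

/-- The generator of square `1` of the added plane. -/
def e : CliffordAlgebra (addPlane Q) := ι (addPlane Q) (0, 1, 0)

/-- The generator of square `-1` of the added plane. -/
def f : CliffordAlgebra (addPlane Q) := ι (addPlane Q) (0, 0, 1)

/-- The generators coming from the original module. -/
def v : M →ₗ[R] CliffordAlgebra (addPlane Q) :=
  ι (addPlane Q) ∘ₗ LinearMap.inl _ _ _

theorem ι_eq (m : M) (a b : R) :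
    ι (addPlane Q) (m, a, b) = v Q m + a • e Q + b • f Q := by
  simp [v, e, f, ← map_smul, ← map_add]

theorem e_mul_e : e Q * e Q = 1 :=
  (ι_sq_scalar _ _).trans <| by simp

theorem f_mul_f : f Q * f Q = -1 :=
  (ι_sq_scalar _ _).trans <| by simp

theorem v_mul_v (m : M) : v Q m * v Q m = algebraMap _ _ (Q m) :=
  (ι_sq_scalar _ _).trans <| by simp

theorem e_mul_f : e Q * f Q = -(f Q * e Q) :=
  eq_neg_of_add_eq_zero_left <| (ι_mul_ι_add_swap _ _).trans <| by simp [QuadraticMap.polar]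

theorem v_mul_e (m : M) : v Q m * e Q = -(e Q * v Q m) :=
  eq_neg_of_add_eq_zero_left <| (ι_mul_ι_add_swap _ _).trans <| by simp [QuadraticMap.polar]

theorem v_mul_f (m : M) : v Q m * f Q = -(f Q * v Q m) :=
  eq_neg_of_add_eq_zero_left <| (ι_mul_ι_add_swap _ _).trans <| by simp [QuadraticMap.polar]

@[simp]
theorem involute_e : involute (e Q) = -e Q :=
  involute_ι _

@[simp]
theorem involute_f : involute (f Q) = -f Q :=
  involute_ι _

@[simp]
theorem involute_v (m : M) : involute (v Q m) = -v Q m :=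
  involute_ι _

theorem commute_f_mul_e_v (m : M) : Commute (f Q * e Q) (v Q m) := by
  rw [commute_iff_eq, ← mul_assoc, v_mul_f, neg_mul, mul_assoc (f Q) (v Q m), v_mul_e, mul_neg,
    neg_neg, mul_assoc]

theorem f_mul_e_mul_self : f Q * e Q * (f Q * e Q) = 1 := by
  rw [mul_assoc, ← mul_assoc (e Q), e_mul_f, neg_mul, mul_assoc (f Q) (e Q), e_mul_e, mul_one,
    mul_neg, f_mul_f, neg_neg]

/-- The embedding of the Clifford algebra of `Q` onto the centralizer of the added plane. -/
def ofClifford : CliffordAlgebra Q →ₐ[R] CliffordAlgebra (addPlane Q) :=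
  lift Q ⟨LinearMap.mulLeft R (f Q * e Q) ∘ₗ v Q, fun m => by
    simp only [LinearMap.comp_apply, LinearMap.mulLeft_apply]
    rw [mul_assoc, ← mul_assoc (v Q m), ← (commute_f_mul_e_v Q m).eq, mul_assoc (f Q * e Q),
      v_mul_v, ← mul_assoc, f_mul_e_mul_self, one_mul]⟩

@[simp]
theorem ofClifford_ι (m : M) : ofClifford Q (ι Q m) = f Q * e Q * v Q m := by
  simp [ofClifford, mul_assoc]

theorem involute_ofClifford (x : CliffordAlgebra Q) :
    involute (ofClifford Q x) = ofClifford Q (involute x) := by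
  suffices h : involute.comp (ofClifford Q) = (ofClifford Q).comp involute from
    DFunLike.congr_fun h x
  ext m
  simp

theorem commute_ofClifford {y : CliffordAlgebra (addPlane Q)}
    (hy : ∀ m, Commute y (f Q * e Q * v Q m)) (x : CliffordAlgebra Q) :
    Commute y (ofClifford Q x) := by
  induction x using CliffordAlgebra.induction with
  | algebraMap r => rw [AlgHom.commutes]; exact (Algebra.commutes r y).symm
  | ι m => rw [ofClifford_ι]; exact hy m
  | mul a b ha hb => rw [map_mul]; exact ha.mul_right hb
  | add a b ha hb => rw [map_add]; exact ha.add_right hb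

theorem commute_e_ofClifford (x : CliffordAlgebra Q) : Commute (e Q) (ofClifford Q x) :=
  commute_ofClifford Q (fun m => by
    rw [commute_iff_eq, mul_assoc (f Q * e Q), v_mul_e, ← mul_assoc, ← mul_assoc, e_mul_f, mul_neg,
      ← mul_assoc, neg_mul, neg_mul]) x

theorem commute_f_ofClifford (x : CliffordAlgebra Q) : Commute (f Q) (ofClifford Q x) :=
  commute_ofClifford Q (fun m => by
    rw [commute_iff_eq, mul_assoc (f Q * e Q), v_mul_f, mul_neg, ← mul_assoc (f Q * e Q),
      mul_assoc (f Q) (e Q) (f Q), e_mul_f, mul_neg, neg_mul, neg_neg,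
      mul_assoc (f Q) (f Q * e Q)]) x

/-- The algebra morphism to `M₂(R) ⊗ Cl(Q)` determined by the Clifford generators. -/
def toTensor :
    CliffordAlgebra (addPlane Q) →ₐ[R] Matrix (Fin 2) (Fin 2) R ⊗[R] CliffordAlgebra Q :=
  lift (addPlane Q) ⟨
    (TensorProduct.mk R (Matrix (Fin 2) (Fin 2) R) (CliffordAlgebra Q) !![1, 0; 0, -1] ∘ₗ
        ι Q).coprod
      (((LinearMap.toSpanSingleton R _ (!![0, 1; 1, 0] ⊗ₜ[R] 1))).coprod
        (LinearMap.toSpanSingleton R _ (!![0, 1; -1, 0] ⊗ₜ[R] 1))), by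
    rintro ⟨m, a, b⟩
    have h1 : (!![1, 0; 0, -1] : Matrix (Fin 2) (Fin 2) R) * !![1, 0; 0, -1] = 1 := by
      ext i j; fin_cases i <;> fin_cases j <;> simp
    have h2 : (!![0, 1; 1, 0] : Matrix (Fin 2) (Fin 2) R) * !![0, 1; 1, 0] = 1 := by
      ext i j; fin_cases i <;> fin_cases j <;> simp
    have h3 : (!![0, 1; -1, 0] : Matrix (Fin 2) (Fin 2) R) * !![0, 1; -1, 0] = -1 := by
      ext i j; fin_cases i <;> fin_cases j <;> simp
    have h4 : (!![0, 1; 1, 0] : Matrix (Fin 2) (Fin 2) R) * !![0, 1; -1, 0] =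
        -(!![0, 1; -1, 0] * !![0, 1; 1, 0]) := by
      ext i j; fin_cases i <;> fin_cases j <;> simp
    have h5 : (!![1, 0; 0, -1] : Matrix (Fin 2) (Fin 2) R) * !![0, 1; 1, 0] =
        -(!![0, 1; 1, 0] * !![1, 0; 0, -1]) := by
      ext i j; fin_cases i <;> fin_cases j <;> simp
    have h6 : (!![1, 0; 0, -1] : Matrix (Fin 2) (Fin 2) R) * !![0, 1; -1, 0] =
        -(!![0, 1; -1, 0] * !![1, 0; 0, -1]) := by
      ext i j; fin_cases i <;> fin_cases j <;> simp
    simp only [LinearMap.coprod_apply, LinearMap.comp_apply, TensorProduct.mk_apply,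
      LinearMap.toSpanSingleton_apply, mul_add, add_mul, smul_mul_assoc,
      mul_smul_comm, Algebra.TensorProduct.tmul_mul_tmul, mul_one, one_mul, ι_sq_scalar,
      h1, h2, h3, h4, h5, h6, TensorProduct.tmul_smul, TensorProduct.neg_tmul,
      ← Algebra.TensorProduct.one_def,
      Algebra.algebraMap_eq_smul_one, QuadraticMap.prod_apply, QuadraticMap.sq_apply,
      neg_apply]
    module⟩

theorem toTensor_v (m : M) : toTensor Q (v Q m) = !![1, 0; 0, -1] ⊗ₜ[R] ι Q m :=
  (lift_ι_apply _ _ _).trans <| by simp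

theorem toTensor_e : toTensor Q (e Q) = !![0, 1; 1, 0] ⊗ₜ[R] 1 :=
  (lift_ι_apply _ _ _).trans <| by simp

theorem toTensor_f : toTensor Q (f Q) = !![0, 1; -1, 0] ⊗ₜ[R] 1 :=
  (lift_ι_apply _ _ _).trans <| by simp

theorem toTensor_f_mul_e : toTensor Q (f Q * e Q) = !![1, 0; 0, -1] ⊗ₜ[R] 1 := by
  rw [map_mul, toTensor_f, toTensor_e, Algebra.TensorProduct.tmul_mul_tmul, mul_one]
  simp

theorem toTensor_ofClifford (x : CliffordAlgebra Q) :
    toTensor Q (ofClifford Q x) = 1 ⊗ₜ[R] x := by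
  suffices h : (toTensor Q).comp (ofClifford Q) = Algebra.TensorProduct.includeRight from
    DFunLike.congr_fun h x
  ext m
  have h : (!![1, 0; 0, -1] : Matrix (Fin 2) (Fin 2) R) * !![1, 0; 0, -1] = 1 := by
    ext i j; fin_cases i <;> fin_cases j <;> simp
  simp only [AlgHom.comp_toLinearMap, LinearMap.comp_apply, AlgHom.toLinearMap_apply,
    ofClifford_ι]
  rw [map_mul, toTensor_f_mul_e, toTensor_v, Algebra.TensorProduct.tmul_mul_tmul, one_mul, h]
  simp

variable [Invertible (2 : R)]

/-- The embedding of `2 × 2` matrices generated by the added plane. -/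
def ofMatrix : Matrix (Fin 2) (Fin 2) R →ₐ[R] CliffordAlgebra (addPlane Q) :=
  matrixLift (e Q) (f Q) (e_mul_e Q) (f_mul_f Q) (e_mul_f Q)

theorem ofMatrix_apply (m : Matrix (Fin 2) (Fin 2) R) :
    ofMatrix Q m = (⅟2 * (m 0 0 + m 1 1) : R) • (1 : CliffordAlgebra (addPlane Q)) +
        (⅟2 * (m 0 0 - m 1 1) : R) • (f Q * e Q) +
        (⅟2 * (m 0 1 + m 1 0) : R) • e Q + (⅟2 * (m 0 1 - m 1 0) : R) • f Q :=
  rfl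

theorem involute_ofMatrix (m : Matrix (Fin 2) (Fin 2) R) :
    involute (ofMatrix Q m) = ofMatrix Q (!![1, 0; 0, -1] * m * !![1, 0; 0, -1]) := by
  have h : !![1, 0; 0, -1] * m * !![1, 0; 0, -1] = !![m 0 0, -m 0 1; -m 1 0, m 1 1] := by
    ext i j; fin_cases i <;> fin_cases j <;> simp [Matrix.mul_apply, Matrix.vecMul, dotProduct]
  simp only [h, ofMatrix_apply, map_add, map_smul, map_one, map_mul, involute_e, involute_f,
    Matrix.of_apply, Matrix.cons_val', Matrix.cons_val_zero, Matrix.cons_val_one,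
    Matrix.cons_val_fin_one, neg_mul_neg]
  module

theorem commute_ofMatrix_ofClifford (m : Matrix (Fin 2) (Fin 2) R) (x : CliffordAlgebra Q) :
    Commute (ofMatrix Q m) (ofClifford Q x) := by
  have he := commute_e_ofClifford Q x
  have hf := commute_f_ofClifford Q x
  rw [ofMatrix_apply]
  exact ((((Commute.one_left _).smul_left _).add_left ((hf.mul_left he).smul_left _)).add_left
    (he.smul_left _)).add_left (hf.smul_left _)

theorem toTensor_ofMatrix (m : Matrix (Fin 2) (Fin 2) R) :
    toTensor Q (ofMatrix Q m) = m ⊗ₜ[R] 1 := by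
  have h2 : (⅟2 : R) * 2 = 1 := invOf_mul_self 2
  simp only [ofMatrix_apply, map_add, map_smul, map_one, toTensor_f_mul_e, toTensor_e, toTensor_f,
    Algebra.TensorProduct.one_def, ← TensorProduct.add_tmul, TensorProduct.smul_tmul']
  congr 1
  ext i j
  fin_cases i <;> fin_cases j <;> simp <;> grind

/-- The algebra morphism from `M₂(R) ⊗ Cl(Q)` combining `ofMatrix` and `ofClifford`. -/
def ofTensor :
    Matrix (Fin 2) (Fin 2) R ⊗[R] CliffordAlgebra Q →ₐ[R] CliffordAlgebra (addPlane Q) :=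
  Algebra.TensorProduct.lift (ofMatrix Q) (ofClifford Q) (commute_ofMatrix_ofClifford Q)

theorem ofTensor_tmul (m : Matrix (Fin 2) (Fin 2) R) (x : CliffordAlgebra Q) :
    ofTensor Q (m ⊗ₜ[R] x) = ofMatrix Q m * ofClifford Q x :=
  Algebra.TensorProduct.lift_tmul _ _ _ _ _

theorem toTensor_ofTensor (t : Matrix (Fin 2) (Fin 2) R ⊗[R] CliffordAlgebra Q) :
    toTensor Q (ofTensor Q t) = t := by
  suffices h : (toTensor Q).comp (ofTensor Q) = AlgHom.id R _ from DFunLike.congr_fun h t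
  refine Algebra.TensorProduct.ext' fun m x => ?_
  rw [AlgHom.comp_apply, ofTensor_tmul, map_mul, toTensor_ofMatrix, toTensor_ofClifford,
    Algebra.TensorProduct.tmul_mul_tmul, mul_one, one_mul, AlgHom.id_apply]

theorem ofTensor_toTensor (y : CliffordAlgebra (addPlane Q)) :
    ofTensor Q (toTensor Q y) = y := by
  suffices h : (ofTensor Q).comp (toTensor Q) = AlgHom.id R _ from DFunLike.congr_fun h y
  have h2 : (⅟2 : R) * (1 + 1) = 1 := by rw [one_add_one_eq_two, invOf_mul_self]
  refine hom_ext (LinearMap.ext ?_)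
  rintro ⟨m, a, b⟩
  simp only [LinearMap.comp_apply, AlgHom.toLinearMap_apply, AlgHom.comp_apply, AlgHom.id_apply,
    ι_eq, map_add, map_smul, toTensor_v, toTensor_e, toTensor_f, ofTensor_tmul, ofClifford_ι,
    map_one, mul_one]
  congr 2
  · have h : ofMatrix Q !![1, 0; 0, -1] = f Q * e Q := by simp [ofMatrix_apply, h2]
    rw [h, ← mul_assoc, f_mul_e_mul_self, one_mul]
  · simp [ofMatrix_apply, h2]
  · simp [ofMatrix_apply, h2]

/-- `M₂(R) ⊗ Cl(Q)` is the Clifford algebra of the sum of `Q` and a hyperbolic plane. -/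
def tensorEquiv :
    (Matrix (Fin 2) (Fin 2) R ⊗[R] CliffordAlgebra Q) ≃ₐ[R] CliffordAlgebra (addPlane Q) :=
  AlgEquiv.ofAlgHom (ofTensor Q) (toTensor Q) (AlgHom.ext (ofTensor_toTensor Q))
    (AlgHom.ext (toTensor_ofTensor Q))

theorem tensorEquiv_apply (t : Matrix (Fin 2) (Fin 2) R ⊗[R] CliffordAlgebra Q) :
    tensorEquiv Q t = ofTensor Q t :=
  rfl

theorem tensorEquiv_involute (m : Matrix (Fin 2) (Fin 2) R) (x : CliffordAlgebra Q) :
    tensorEquiv Q ((!![1, 0; 0, -1] * m * !![1, 0; 0, -1]) ⊗ₜ[R] involute x) =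
      involute (tensorEquiv Q (m ⊗ₜ[R] x)) := by
  rw [tensorEquiv_apply, tensorEquiv_apply, ofTensor_tmul, ofTensor_tmul, map_mul involute,
    involute_ofMatrix, involute_ofClifford]

end addPlane

end AddPlane

theorem map_involute {R M₁ M₂ : Type*} [CommRing R] [AddCommGroup M₁] [AddCommGroup M₂]
    [Module R M₁] [Module R M₂] {Q₁ : QuadraticForm R M₁} {Q₂ : QuadraticForm R M₂}
    (g : Q₁ →qᵢ Q₂) (x : CliffordAlgebra Q₁) :
    map g (involute x) = involute (map g x) := by
  suffices h : (map g).comp involute = involute.comp (map g) from DFunLike.congr_fun h x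
  ext m
  simp

end CliffordAlgebra

/-- `Q_{r+1,s+1}` is the orthogonal sum of `Q_{r,s}` and a hyperbolic plane. -/
noncomputable def addPlaneIsometry (r s : ℕ) :
    (addPlane (Qform r s)).IsometryEquiv (Qform (r + 1) (s + 1)) where
  toFun p := (Fin.cons p.2.1 p.1.1, Fin.cons p.2.2 p.1.2)
  invFun q := ((Fin.tail q.1, Fin.tail q.2), q.1 0, q.2 0)
  left_inv p := by simp
  right_inv q := by simp
  map_add' p q := by
    refine Prod.ext (funext fun i => ?_) (funext fun i => ?_) <;>
      refine Fin.cases ?_ (fun j => ?_) i <;> simp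
  map_smul' c p := by
    refine Prod.ext (funext fun i => ?_) (funext fun i => ?_) <;>
      refine Fin.cases ?_ (fun j => ?_) i <;> simp
  map_app' p := by
    simp [Qform, QuadraticMap.weightedSumSquares_apply, Fin.sum_univ_succ]
    ring

/-- `(M₂(ℝ) ⊗ Cl_{r,s}, Ad_{σ_z} ⊗ st) ≅ (Cl_{r+1,s+1}, st)` as graded real algebras. -/
theorem matrix_tensor_clifford_iso (r s : ℕ) :
    ∃ Φ : (Matrix (Fin 2) (Fin 2) ℝ ⊗[ℝ] CliffordAlgebra (Qform r s)) ≃ₐ[ℝ]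
        CliffordAlgebra (Qform (r + 1) (s + 1)),
      ∀ (m : Matrix (Fin 2) (Fin 2) ℝ) (x : CliffordAlgebra (Qform r s)),
        Φ ((sigmaZ * m * sigmaZ) ⊗ₜ[ℝ] involute x) = involute (Φ (m ⊗ₜ[ℝ] x)) := by
  let E := equivOfIsometry (addPlaneIsometry r s)
  refine ⟨(addPlane.tensorEquiv (Qform r s)).trans E, fun m x => ?_⟩
  rw [AlgEquiv.trans_apply, AlgEquiv.trans_apply, sigmaZ, addPlane.tensorEquiv_involute]
  exact map_involute (addPlaneIsometry r s).toIsometry _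
end
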